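/- arXiv:1104.5567 — 2 statements merged into one kernel-verified Lean document; each statement's English description precedes it below -/
import Mathlib

section
/- Under conditions (1) and (2) of Assumption (A1), the forcing f(t,u,z) is locally Lipschitz continuous in z in the V′ norm: for all (ω,t) ∈ Ω×[0,T], all u ∈ V and all z, Z ∈ H, ‖f(t,u,z) − f(t,u,Z)‖_{V′} ≤ C(‖u‖_V) ‖z − Z‖, where C(‖u‖_V) is a constant depending only on ‖u‖_V (through the locally bounded function ρ of (A1)(2)). -/
open scoped RealInnerProductSpace

/-- Remark 2.1: under conditions (1) and (2) of Assumption (A1), the forcing `f(t,u,z)`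
is locally Lipschitz continuous in `z` in the `V′` norm:
`‖f(t,u,z) − f(t,u,Z)‖_{V′} ≤ C(‖u‖_V) ‖z − Z‖` for all `(ω,t) ∈ Ω×[0,T]`, `u ∈ V`,
`z, Z ∈ H`, where `C(‖u‖_V)` depends only on `‖u‖_V`.  The `V′`-norm bound is
expressed by pairing against an arbitrary test element `φ ∈ V`. -/
theorem forcing_locally_lipschitz_in_z
    {H V : Type*} [NormedAddCommGroup H] [InnerProductSpace ℝ H]
    [NormedAddCommGroup V] [InnerProductSpace ℝ V]
    {Ω : Type*} (T : ℝ) (hT : 0 < T)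
    (ι : V →L[ℝ] H)
    (hPoincare : ∃ c : ℝ, 0 < c ∧ ∀ v : V, ‖ι v‖ ≤ c * ‖v‖)
    (f : Ω → ℝ → V → H → H)
    (ρ : V → ℝ) (hρ_pos : ∀ v, 0 < ρ v)
    (hρ_locbdd : ∀ r : ℝ, ∃ M : ℝ, ∀ v : V, ‖v‖ ≤ r → ρ v ≤ M)
    (hf_cont : ∀ (ω : Ω) (t : ℝ) (v₁ v₂ v : V) (φ : H),
      Continuous (fun s : ℝ => ⟪f ω t (v₁ + s • v₂) φ, ι v⟫))
    (hf_mono : ∀ (ω : Ω) (t : ℝ) (v₁ v₂ : V) (φ₁ φ₂ : H),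
      ⟪f ω t v₁ φ₁ - f ω t v₂ φ₂, ι (v₁ - v₂)⟫ ≤
        ρ v₂ * (‖ι (v₁ - v₂)‖ ^ 2 + ‖ι (v₁ - v₂)‖ * (‖φ₁ - φ₂‖ + ‖v₁ - v₂‖))) :
    ∃ C : ℝ → ℝ, (∀ r, 0 ≤ C r) ∧
      ∀ (ω : Ω), ∀ t ∈ Set.Icc (0:ℝ) T, ∀ (u : V) (z Z : H), ∀ φ : V,
        ⟪f ω t u z - f ω t u Z, ι φ⟫ ≤ C ‖u‖ * ‖z - Z‖ * ‖φ‖ := by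
  obtain ⟨c, hc, hι⟩ := hPoincare
  choose M hM using hρ_locbdd
  refine ⟨fun r => max (M r) 0 * c, fun r => by positivity, ?_⟩
  intro ω t _ u z Z φ
  have key : ⟪f ω t u z - f ω t u Z, ι φ⟫ ≤ ρ u * (‖ι φ‖ * ‖z - Z‖) := by
    have hcont : Continuous (fun s : ℝ => ⟪f ω t (u + s • φ) z, ι φ⟫ - ⟪f ω t u Z, ι φ⟫) :=
      (hf_cont ω t u φ φ z).sub continuous_const
    have hbound : Continuous (fun s : ℝ =>
        ρ u * (s * ‖ι φ‖ ^ 2 + ‖ι φ‖ * (‖z - Z‖ + s * ‖φ‖))) := by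
      fun_prop
    have hle : ∀ᶠ s in nhdsWithin (0 : ℝ) (Set.Ioi 0),
        ⟪f ω t (u + s • φ) z, ι φ⟫ - ⟪f ω t u Z, ι φ⟫ ≤
          ρ u * (s * ‖ι φ‖ ^ 2 + ‖ι φ‖ * (‖z - Z‖ + s * ‖φ‖)) := by
      filter_upwards [self_mem_nhdsWithin] with s hs
      have hs : 0 < s := hs
      have h := hf_mono ω t (u + s • φ) u z Z
      rw [add_sub_cancel_left, map_smul, inner_smul_right, norm_smul, norm_smul,
        Real.norm_of_nonneg hs.le, inner_sub_left] at h
      refine le_of_mul_le_mul_left (h.trans_eq ?_) hs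
      ring
    have h := le_of_tendsto_of_tendsto
      ((hcont.tendsto 0).mono_left nhdsWithin_le_nhds)
      ((hbound.tendsto 0).mono_left nhdsWithin_le_nhds) hle
    simpa [inner_sub_left] using h
  calc ⟪f ω t u z - f ω t u Z, ι φ⟫ ≤ ρ u * (‖ι φ‖ * ‖z - Z‖) := key
    _ ≤ max (M ‖u‖) 0 * (c * ‖φ‖ * ‖z - Z‖) := by
      gcongr
      · exact (hM ‖u‖ u le_rfl).trans (le_max_left _ _)
      · exact hι φ
    _ = max (M ‖u‖) 0 * c * ‖z - Z‖ * ‖φ‖ := by ring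
end

section
/- In the space-periodic case, the nonlinear term is orthogonal to the Laplacian: ⟨Π(v,v), Δv⟩ = 0 for every v ∈ D(A). -/
open MeasureTheory

noncomputable section

/-- The two-dimensional Euclidean space. -/
local notation "E2" => EuclideanSpace ℝ (Fin 2)

/-- The period cell `G = (0,a)²`. -/
def cell (a : ℝ) : Set (EuclideanSpace ℝ (Fin 2)) := {x | ∀ i, x i ∈ Set.Ioo 0 a}

/-- `u` is `G`-periodic with period `a` in each direction. -/
def IsPeriodic (a : ℝ) (u : EuclideanSpace ℝ (Fin 2) → EuclideanSpace ℝ (Fin 2)) : Prop :=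
  ∀ (x : EuclideanSpace ℝ (Fin 2)) (i : Fin 2), u (x + EuclideanSpace.single i a) = u x

/-- `u` is divergence free. -/
def DivFree (u : EuclideanSpace ℝ (Fin 2) → EuclideanSpace ℝ (Fin 2)) : Prop :=
  ∀ x, ∑ i : Fin 2, fderiv ℝ u x (EuclideanSpace.single i (1:ℝ)) i = 0

/-- `u` has zero mean over the period cell. -/
def MeanZero (a : ℝ) (u : EuclideanSpace ℝ (Fin 2) → EuclideanSpace ℝ (Fin 2)) : Prop :=
  ∫ x in cell a, u x = 0

/-- Membership in `H`: square-integrable (here: continuous), periodic, mean-zero,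
divergence-free vector fields. -/
def MemH (a : ℝ) (u : EuclideanSpace ℝ (Fin 2) → EuclideanSpace ℝ (Fin 2)) : Prop :=
  Continuous u ∧ IsPeriodic a u ∧ MeanZero a u ∧ DivFree u

/-- Membership in `V`: `H¹` (here: `C¹`), periodic, mean-zero, divergence-free. -/
def MemV (a : ℝ) (u : EuclideanSpace ℝ (Fin 2) → EuclideanSpace ℝ (Fin 2)) : Prop :=
  ContDiff ℝ 1 u ∧ IsPeriodic a u ∧ MeanZero a u ∧ DivFree u

/-- Membership in `D(A)`: `H²` (here: `C²`), periodic, mean-zero, divergence-free. -/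
def MemDA (a : ℝ) (u : EuclideanSpace ℝ (Fin 2) → EuclideanSpace ℝ (Fin 2)) : Prop :=
  ContDiff ℝ 2 u ∧ IsPeriodic a u ∧ MeanZero a u ∧ DivFree u

/-- The trilinear form `b(u,v,w) = Σ_{i,j} ∫_G u_i ∂_i v_j w_j dx`. -/
def triB (a : ℝ) (u v w : EuclideanSpace ℝ (Fin 2) → EuclideanSpace ℝ (Fin 2)) : ℝ :=
  ∫ x in cell a, ∑ i : Fin 2, ∑ j : Fin 2,
    u x i * fderiv ℝ v x (EuclideanSpace.single i (1:ℝ)) j * w x j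

/-- The `H` (i.e. `L²(G)`) norm. -/
def Hnorm (a : ℝ) (u : EuclideanSpace ℝ (Fin 2) → EuclideanSpace ℝ (Fin 2)) : ℝ :=
  Real.sqrt (∫ x in cell a, ‖u x‖ ^ 2)

/-- The `V` norm `‖∇u‖_{L²(G)}`. -/
def Vnorm (a : ℝ) (u : EuclideanSpace ℝ (Fin 2) → EuclideanSpace ℝ (Fin 2)) : ℝ :=
  Real.sqrt (∫ x in cell a, ∑ i : Fin 2, ‖fderiv ℝ u x (EuclideanSpace.single i (1:ℝ))‖ ^ 2)

/-- The Laplacian of a vector field. -/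
def lap (u : EuclideanSpace ℝ (Fin 2) → EuclideanSpace ℝ (Fin 2)) (x : EuclideanSpace ℝ (Fin 2)) :
    EuclideanSpace ℝ (Fin 2) :=
  ∑ j : Fin 2, fderiv ℝ (fun y => fderiv ℝ u y (EuclideanSpace.single j (1:ℝ))) x
    (EuclideanSpace.single j (1:ℝ))

/-- `‖Au‖ = ‖Δu‖_{L²(G)}` for periodic divergence-free fields. -/
def Anorm (a : ℝ) (u : EuclideanSpace ℝ (Fin 2) → EuclideanSpace ℝ (Fin 2)) : ℝ :=
  Real.sqrt (∫ x in cell a, ‖lap u x‖ ^ 2)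

/-- The convective term `(u·∇)u`. -/
def convTerm (u : EuclideanSpace ℝ (Fin 2) → EuclideanSpace ℝ (Fin 2))
    (x : EuclideanSpace ℝ (Fin 2)) : EuclideanSpace ℝ (Fin 2) :=
  ∑ i : Fin 2, u x i • fderiv ℝ u x (EuclideanSpace.single i (1:ℝ))

/-- The integral over the period cell of the divergence of a `C¹` periodic field vanishes. -/
theorem integral_cell_divergence_eq_zero {a : ℝ} (ha : 0 < a)
    (W : Fin 2 → EuclideanSpace ℝ (Fin 2) → ℝ) (hW : ∀ i, ContDiff ℝ 1 (W i))
    (hper : ∀ k x (i : Fin 2), W k (x + EuclideanSpace.single i a) = W k x) :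
    ∫ x in cell a, ∑ i : Fin 2, fderiv ℝ (W i) x (EuclideanSpace.single i (1:ℝ)) = 0 := by
  let L := (PiLp.continuousLinearEquiv 2 ℝ (fun _ : Fin 2 => ℝ)).symm
  have hcont : Continuous fun x : Fin 2 → ℝ =>
      ∑ i : Fin 2, ((fderiv ℝ (W i) (L x)).comp (L : (Fin 2 → ℝ) →L[ℝ] _)) (Pi.single i 1) := by
    refine continuous_finsetSum _ fun i _ => ?_
    exact (((hW i).continuous_fderiv one_ne_zero).comp L.continuous).clm_apply continuous_const
  have hdiv := integral_divergence_of_hasFDerivAt_off_countable' (E := ℝ) (n := 1)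
    (0 : Fin 2 → ℝ) (fun _ => a) (fun _ => ha.le) (fun i x => W i (L x))
    (fun i x => (fderiv ℝ (W i) (L x)).comp (L : (Fin 2 → ℝ) →L[ℝ] _)) ∅ Set.countable_empty
    (fun i => ((hW i).continuous.comp L.continuous).continuousOn)
    (fun x _ i => (((hW i).differentiable one_ne_zero) (L x)).hasFDerivAt.comp x L.hasFDerivAt)
    (hcont.continuousOn.integrableOn_compact isCompact_Icc)
  have hfaces : ∀ (i : Fin 2) (x : Fin 1 → ℝ),
      W i (L (i.insertNth a x)) = W i (L (i.insertNth 0 x)) := by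
    intro i x
    rw [← hper i (L (i.insertNth 0 x)) i]
    congr 1
    ext j
    obtain rfl | ⟨j, rfl⟩ := Fin.eq_self_or_eq_succAbove i j <;> simp [L]
  have hcell : L ⁻¹' cell a = Set.pi Set.univ fun _ => Set.Ioo 0 a := by
    ext x
    simp [cell, L]
  rw [← (PiLp.volume_preserving_toLp (Fin 2)).setIntegral_preimage_emb
    (MeasurableEquiv.toLp 2 (Fin 2 → ℝ)).measurableEmbedding]
  change ∫ x in L ⁻¹' cell a, ∑ i : Fin 2, fderiv ℝ (W i) (L x) (EuclideanSpace.single i 1) = 0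
  rw [hcell, volume_pi, setIntegral_congr_set Measure.univ_pi_Ioo_ae_eq_Icc]
  refine hdiv.trans (Finset.sum_eq_zero fun i _ => ?_)
  simp only [Pi.zero_apply, hfaces, sub_self]

/-- The flux `W_k = Σ_{i,j} v_i ∂_i v_j ∂_k v_j - ½ v_k |∇v|²`, whose divergence is
`(v·∇)v · Δv` when `v` is a plane divergence-free field. -/
def convFlux (v : EuclideanSpace ℝ (Fin 2) → EuclideanSpace ℝ (Fin 2)) (k : Fin 2)
    (x : EuclideanSpace ℝ (Fin 2)) : ℝ :=
  ∑ i : Fin 2, ∑ j : Fin 2,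
    (v x i * (fderiv ℝ v x (EuclideanSpace.single i (1:ℝ)) j *
        fderiv ℝ v x (EuclideanSpace.single k (1:ℝ)) j) -
      1 / 2 * (v x k * (fderiv ℝ v x (EuclideanSpace.single i (1:ℝ)) j *
        fderiv ℝ v x (EuclideanSpace.single i (1:ℝ)) j)))

theorem contDiff_fderiv_apply {v : EuclideanSpace ℝ (Fin 2) → EuclideanSpace ℝ (Fin 2)}
    (hv : ContDiff ℝ 2 v) (w : EuclideanSpace ℝ (Fin 2)) :
    ContDiff ℝ 1 fun x => fderiv ℝ v x w :=
  (hv.fderiv_right (m := 1) (by norm_num)).clm_apply contDiff_const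

theorem contDiff_convFlux {v : EuclideanSpace ℝ (Fin 2) → EuclideanSpace ℝ (Fin 2)}
    (hv : ContDiff ℝ 2 v) (k : Fin 2) : ContDiff ℝ 1 (convFlux v k) := by
  have hu : ∀ j, ContDiff ℝ 1 fun x => v x j := fun j =>
    contDiff_euclidean.1 (hv.of_le (by norm_num)) j
  have hD : ∀ i j, ContDiff ℝ 1 fun x => fderiv ℝ v x (EuclideanSpace.single i (1:ℝ)) j :=
    fun i j => contDiff_euclidean.1 (contDiff_fderiv_apply hv _) j
  refine ContDiff.sum fun i _ => ContDiff.sum fun j _ => ?_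
  exact ((hu i).mul ((hD i j).mul (hD k j))).sub
    (contDiff_const.mul ((hu k).mul ((hD i j).mul (hD i j))))

theorem convFlux_periodic {a : ℝ} {v : EuclideanSpace ℝ (Fin 2) → EuclideanSpace ℝ (Fin 2)}
    (hv : IsPeriodic a v) (k : Fin 2) (x : EuclideanSpace ℝ (Fin 2)) (i : Fin 2) :
    convFlux v k (x + EuclideanSpace.single i a) = convFlux v k x := by
  have hD : fderiv ℝ v (x + EuclideanSpace.single i a) = fderiv ℝ v x := by
    rw [← fderiv_comp_add_right]
    exact congrArg (fun f => fderiv ℝ f x) (funext fun y => hv y i)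
  simp only [convFlux, hD, hv x i]

theorem fderiv_fderiv_apply_comm {v : EuclideanSpace ℝ (Fin 2) → EuclideanSpace ℝ (Fin 2)}
    (hv : ContDiff ℝ 2 v) (x w z : EuclideanSpace ℝ (Fin 2)) :
    fderiv ℝ (fun y => fderiv ℝ v y w) x z = fderiv ℝ (fun y => fderiv ℝ v y z) x w := by
  have hd : DifferentiableAt ℝ (fderiv ℝ v) x :=
    (hv.fderiv_right (m := 1) (by norm_num)).differentiable one_ne_zero x
  have hsymm : IsSymmSndFDerivAt ℝ v x := hv.contDiffAt.isSymmSndFDerivAt (by simp)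
  have happ : ∀ w z, fderiv ℝ (fun y => fderiv ℝ v y w) x z = fderiv ℝ (fderiv ℝ v) x z w := by
    intro w z
    rw [(hd.hasFDerivAt.clm_apply (hasFDerivAt_const w x)).fderiv]
    simp
  rw [happ, happ, hsymm.eq]

theorem convTerm_lap_eq_divergence {v : EuclideanSpace ℝ (Fin 2) → EuclideanSpace ℝ (Fin 2)}
    (hv : ContDiff ℝ 2 v) (hdiv : DivFree v) (x : EuclideanSpace ℝ (Fin 2)) :
    ∑ j : Fin 2, convTerm v x j * lap v x j =
      ∑ k : Fin 2, fderiv ℝ (convFlux v k) x (EuclideanSpace.single k (1:ℝ)) := by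
  have hu : ∀ j, HasFDerivAt (fun y => v y j)
      ((EuclideanSpace.proj j : _ →L[ℝ] ℝ).comp (fderiv ℝ v x)) x := fun j =>
    (EuclideanSpace.proj j : _ →L[ℝ] ℝ).hasFDerivAt.comp x
      (hv.differentiable two_ne_zero x).hasFDerivAt
  have hD : ∀ i j, HasFDerivAt (fun y => fderiv ℝ v y (EuclideanSpace.single i (1:ℝ)) j)
      ((EuclideanSpace.proj j : _ →L[ℝ] ℝ).comp
        (fderiv ℝ (fun y => fderiv ℝ v y (EuclideanSpace.single i (1:ℝ))) x)) x := fun i j =>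
    (EuclideanSpace.proj j : _ →L[ℝ] ℝ).hasFDerivAt.comp x
      ((contDiff_fderiv_apply hv _).differentiable one_ne_zero x).hasFDerivAt
  have hflux : ∀ k, HasFDerivAt (convFlux v k) _ x := fun k =>
    HasFDerivAt.fun_sum fun i _ => HasFDerivAt.fun_sum fun j _ =>
      ((hu i).mul ((hD i j).mul (hD k j))).sub
        (((hu k).mul ((hD i j).mul (hD i j))).const_mul (1 / 2))
  have hsymm := fderiv_fderiv_apply_comm hv x (EuclideanSpace.single 0 1)
    (EuclideanSpace.single 1 1)
  have hdivx := hdiv x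
  simp only [(hflux _).fderiv]
  simp only [convTerm, lap, Fin.sum_univ_two, PiLp.add_apply, PiLp.smul_apply, smul_eq_mul,
    _root_.add_apply, _root_.sub_apply, _root_.smul_apply,
    ContinuousLinearMap.comp_apply, PiLp.proj_apply, Pi.mul_apply, hsymm] at hdivx ⊢
  rw [eq_neg_of_add_eq_zero_left hdivx]
  ring

/-- In the space-periodic case the nonlinear term is orthogonal to the Laplacian:
`⟨Π(v,v), Δv⟩ = 0` for every `v ∈ D(A)`.  (Since `Δv ∈ H` for periodic
divergence-free `v`, the Leray projection may be dropped in the pairing.) -/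
theorem convTerm_orthogonal_laplacian (a : ℝ) (ha : 0 < a)
    (v : EuclideanSpace ℝ (Fin 2) → EuclideanSpace ℝ (Fin 2)) (hv : MemDA a v) :
    ∫ x in cell a, ∑ j : Fin 2, convTerm v x j * lap v x j = 0 := by
  obtain ⟨hC, hper, -, hdiv⟩ := hv
  simp only [convTerm_lap_eq_divergence hC hdiv]
  exact integral_cell_divergence_eq_zero ha (convFlux v) (contDiff_convFlux hC)
    (convFlux_periodic hper)

end
end
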